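/- (The Shannon upper bound is achieved by water-filling at high water level.) Let S_N be a measurable, integrable noise power spectrum on I with S_N(f) > 0 a.e. and log S_N integrable, set σ_N² := ∫ S_N(f) df, and let θ satisfy θ ≥ esssup_{f ∈ I} S_N(f). Define the water-filling input spectrum S_X(f) := θ − S_N(f) and the power P := ∫ S_X(f) df. Then P + σ_N² = θ and ∫ (1/2) log( 1 + S_X(f)/S_N(f) ) df = (1/2) log( (P + σ_N²) / P_e(S_N) ). -/

import Mathlib

open MeasureTheory Real Filter

/-- Lebesgue measure restricted to the frequency interval `I = [-1/2, 1/2]`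
(a probability measure). -/
noncomputable def freqMeasure : Measure ℝ :=
  volume.restrict (Set.Icc (-(1/2) : ℝ) (1/2))

instance isProbabilityMeasure_freqMeasure : IsProbabilityMeasure freqMeasure := by
  refine ⟨?_⟩
  rw [freqMeasure, Measure.restrict_apply_univ, Real.volume_Icc]
  norm_num

/-- The Shannon upper bound is achieved by water-filling at high water level:
if `θ ≥ esssup S_N`, then with `S_X = θ − S_N` and `P = ∫ S_X` one has
`P + σ_N² = θ` and `∫ (1/2) log(1 + S_X/S_N) = (1/2) log((P + σ_N²)/P_e(S_N))`. -/
theorem shannon_upper_bound_achieved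
    (SN : ℝ → ℝ) (hmeas : Measurable SN)
    (hpos : ∀ᵐ f ∂freqMeasure, 0 < SN f)
    (hint : Integrable SN freqMeasure)
    (hlog : Integrable (fun f => Real.log (SN f)) freqMeasure)
    (θ : ℝ) (hθ : essSup SN freqMeasure ≤ θ) :
    ((∫ f, (θ - SN f) ∂freqMeasure) + (∫ f, SN f ∂freqMeasure) = θ) ∧
    ∫ f, (1/2) * Real.log (1 + (θ - SN f) / SN f) ∂freqMeasure
      = (1/2) * Real.log
          (((∫ f, (θ - SN f) ∂freqMeasure) + (∫ f, SN f ∂freqMeasure))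
            / Real.exp (∫ f, Real.log (SN f) ∂freqMeasure)) := by
  have hsum : (∫ f, (θ - SN f) ∂freqMeasure) + (∫ f, SN f ∂freqMeasure) = θ := by
    rw [integral_sub (integrable_const θ) hint]
    simp
  refine ⟨hsum, ?_⟩
  have hratio : ∀ᵐ f ∂freqMeasure, 1 + (θ - SN f) / SN f = θ / SN f := by
    filter_upwards [hpos] with f hf
    field_simp
    ring
  rw [hsum, integral_const_mul]
  congr 1
  rcases eq_or_ne θ 0 with rfl | hθ0
  · have hzero : (fun f => Real.log (1 + (0 - SN f) / SN f)) =ᵐ[freqMeasure] 0 := by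
      filter_upwards [hratio] with f hf
      rw [hf, zero_div, Real.log_zero, Pi.zero_apply]
    rw [integral_eq_zero_of_ae hzero, zero_div, Real.log_zero]
  · have hsplit : (fun f => Real.log (1 + (θ - SN f) / SN f)) =ᵐ[freqMeasure]
        fun f => Real.log θ - Real.log (SN f) := by
      filter_upwards [hratio, hpos] with f hf hf0
      rw [hf, Real.log_div hθ0 hf0.ne']
    rw [integral_congr_ae hsplit, integral_sub (integrable_const _) hlog,
      Real.log_div hθ0 (Real.exp_ne_zero _), Real.log_exp]
    simp
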